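/- For every x ∈ U, the second-order Lie brackets are ad²f.g̃1(x) = a(cosθ cosφ + sinθ sinφ sinψ) e_{v_x} + a cosψ sinφ e_{v_y} − a(cosφ sinθ − sinφ cosθ sinψ) e_{v_z} − ω_x e_φ, and ad²f.g̃2(x) = a(cosθ sinφ − sinθ cosφ sinψ) e_{v_x} − a cosφ cosψ e_{v_y} − a(sinφ sinθ + cosφ cosθ sinψ) e_{v_z} + ω_y e_φ. -/

import Mathlib

open Real

/-- Lie bracket of vector fields on ℝ⁸: [X, Y](x) = DY(x)·X(x) − DX(x)·Y(x). -/
noncomputable def lieBracket (X Y : (Fin 8 → ℝ) → (Fin 8 → ℝ)) :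
    (Fin 8 → ℝ) → (Fin 8 → ℝ) :=
  fun x => fderiv ℝ Y x (X x) - fderiv ℝ X x (Y x)

/-- The drift vector field f of (MTCP), in coordinates
x = (v_x, v_y, v_z, θ, ψ, φ, ω_x, ω_y). -/
noncomputable def fMTCP (a gx gy gz : ℝ) : (Fin 8 → ℝ) → (Fin 8 → ℝ) := fun x =>
  ![a * sin (x 3) * cos (x 4) + gx,
    -a * sin (x 4) + gy,
    a * cos (x 3) * cos (x 4) + gz,
    (x 6 * sin (x 5) + x 7 * cos (x 5)) / cos (x 4),
    x 6 * cos (x 5) - x 7 * sin (x 5),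
    tan (x 4) * (x 6 * sin (x 5) + x 7 * cos (x 5)),
    0, 0]

/-- g̃1 = e_{ω_y}. -/
noncomputable def gt1 : (Fin 8 → ℝ) → (Fin 8 → ℝ) := fun _ => Pi.single 7 1

/-- g̃2 = e_{ω_x}. -/
noncomputable def gt2 : (Fin 8 → ℝ) → (Fin 8 → ℝ) := fun _ => Pi.single 6 1

lemma fderiv_apply_eq_of_hasDerivAt {F : (Fin 8 → ℝ) → (Fin 8 → ℝ)} {x : Fin 8 → ℝ}
    (hF : DifferentiableAt ℝ F x) (v : Fin 8 → ℝ) {w : Fin 8 → ℝ}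
    (h : ∀ i, HasDerivAt (fun t : ℝ => F (x + t • v) i) (w i) 0) :
    fderiv ℝ F x v = w := by
  have hline : HasDerivAt (fun t : ℝ => F (x + t • v)) w 0 := hasDerivAt_pi.2 h
  rw [← hF.lineDeriv_eq_fderiv]
  exact hline.deriv

lemma hasDerivAt_add_mul_const (b c : ℝ) : HasDerivAt (fun t : ℝ => b + t * c) c 0 := by
  simpa using ((hasDerivAt_id (0 : ℝ)).mul_const c).const_add b

lemma differentiableAt_tan_apply {i : Fin 8} {x : Fin 8 → ℝ} (hx : cos (x i) ≠ 0) :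
    DifferentiableAt ℝ (fun y : Fin 8 → ℝ => tan (y i)) x :=
  DifferentiableAt.comp (g := tan) x (differentiableAt_tan.2 hx) (differentiableAt_apply i x)

lemma differentiableAt_fMTCP (a gx gy gz : ℝ) {x : Fin 8 → ℝ} (hx : cos (x 4) ≠ 0) :
    DifferentiableAt ℝ (fMTCP a gx gy gz) x := by
  have htan := differentiableAt_tan_apply hx
  rw [differentiableAt_pi]
  intro i
  fin_cases i <;> simp [fMTCP] <;> fun_prop (disch := assumption)

lemma fderiv_fMTCP_apply (a gx gy gz : ℝ) {x : Fin 8 → ℝ} (hx : cos (x 4) ≠ 0)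
    (v : Fin 8 → ℝ) :
    fderiv ℝ (fMTCP a gx gy gz) x v =
      ![a * (cos (x 3) * cos (x 4) * v 3 - sin (x 3) * sin (x 4) * v 4),
        -a * cos (x 4) * v 4,
        -a * (sin (x 3) * cos (x 4) * v 3 + cos (x 3) * sin (x 4) * v 4),
        (sin (x 5) * v 6 + cos (x 5) * v 7 + (x 6 * cos (x 5) - x 7 * sin (x 5)) * v 5) /
            cos (x 4) +
          (x 6 * sin (x 5) + x 7 * cos (x 5)) * sin (x 4) / cos (x 4) ^ 2 * v 4,
        cos (x 5) * v 6 - sin (x 5) * v 7 - (x 6 * sin (x 5) + x 7 * cos (x 5)) * v 5,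
        tan (x 4) * (sin (x 5) * v 6 + cos (x 5) * v 7 +
            (x 6 * cos (x 5) - x 7 * sin (x 5)) * v 5) +
          (x 6 * sin (x 5) + x 7 * cos (x 5)) / cos (x 4) ^ 2 * v 4,
        0, 0] := by
  have hl (i : Fin 8) := hasDerivAt_add_mul_const (x i) (v i)
  have hx' : cos (x 4 + 0 * v 4) ≠ 0 := by simpa using hx
  have htan : HasDerivAt (fun t : ℝ => tan (x 4 + t * v 4))
      (1 / cos (x 4 + 0 * v 4) ^ 2 * v 4) 0 :=
    HasDerivAt.comp (h₂ := tan) 0 (hasDerivAt_tan hx') (hl 4)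
  have hrot := ((hl 6).mul (hl 5).sin).add ((hl 7).mul (hl 5).cos)
  refine fderiv_apply_eq_of_hasDerivAt (differentiableAt_fMTCP a gx gy gz hx) v fun i => ?_
  fin_cases i
  · refine ((((hl 3).sin.const_mul a).mul (hl 4).cos).add_const gx).congr_deriv ?_
    simp; ring
  · refine (((hl 4).sin.const_mul (-a)).add_const gy).congr_deriv ?_
    simp; ring
  · refine ((((hl 3).cos.const_mul a).mul (hl 4).cos).add_const gz).congr_deriv ?_
    simp; ring
  · refine (hrot.div (hl 4).cos hx').congr_deriv ?_
    simp; field_simp; ring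
  · refine (((hl 6).mul (hl 5).cos).sub ((hl 7).mul (hl 5).sin)).congr_deriv ?_
    simp; ring
  · refine (htan.mul hrot).congr_deriv ?_
    simp; ring
  · exact hasDerivAt_const _ _
  · exact hasDerivAt_const _ _

lemma lieBracket_fMTCP_const (a gx gy gz : ℝ) {x : Fin 8 → ℝ} (hx : cos (x 4) ≠ 0)
    (p q : ℝ) :
    lieBracket (fMTCP a gx gy gz) (fun _ => ![0, 0, 0, 0, 0, 0, p, q]) x =
      ![0, 0, 0, -(p * sin (x 5) + q * cos (x 5)) / cos (x 4),
        -(p * cos (x 5) - q * sin (x 5)),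
        -tan (x 4) * (p * sin (x 5) + q * cos (x 5)), 0, 0] := by
  rw [lieBracket, fderiv_fMTCP_apply a gx gy gz hx]
  ext i
  fin_cases i <;> simp [-mul_eq_mul_left_iff] <;> ring

lemma fderiv_firstBracket_apply (p q : ℝ) {x : Fin 8 → ℝ} (hx : cos (x 4) ≠ 0)
    (v : Fin 8 → ℝ) :
    fderiv ℝ (fun y : Fin 8 → ℝ =>
      ![0, 0, 0, -(p * sin (y 5) + q * cos (y 5)) / cos (y 4),
        -(p * cos (y 5) - q * sin (y 5)),
        -tan (y 4) * (p * sin (y 5) + q * cos (y 5)), 0, 0]) x v =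
      ![0, 0, 0,
        -(p * cos (x 5) - q * sin (x 5)) * v 5 / cos (x 4) -
          (p * sin (x 5) + q * cos (x 5)) * sin (x 4) / cos (x 4) ^ 2 * v 4,
        (p * sin (x 5) + q * cos (x 5)) * v 5,
        -tan (x 4) * (p * cos (x 5) - q * sin (x 5)) * v 5 -
          (p * sin (x 5) + q * cos (x 5)) / cos (x 4) ^ 2 * v 4,
        0, 0] := by
  have hl (i : Fin 8) := hasDerivAt_add_mul_const (x i) (v i)
  have hx' : cos (x 4 + 0 * v 4) ≠ 0 := by simpa using hx
  have htan : HasDerivAt (fun t : ℝ => tan (x 4 + t * v 4))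
      (1 / cos (x 4 + 0 * v 4) ^ 2 * v 4) 0 :=
    HasDerivAt.comp (h₂ := tan) 0 (hasDerivAt_tan hx') (hl 4)
  have hrot := ((hl 5).sin.const_mul p).add ((hl 5).cos.const_mul q)
  have hdiff := differentiableAt_tan_apply hx
  refine fderiv_apply_eq_of_hasDerivAt ?_ v fun i => ?_
  · rw [differentiableAt_pi]
    intro i
    fin_cases i <;> simp <;> fun_prop (disch := assumption)
  fin_cases i
  · exact hasDerivAt_const _ _
  · exact hasDerivAt_const _ _
  · exact hasDerivAt_const _ _
  · refine (hrot.neg.div (hl 4).cos hx').congr_deriv ?_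
    simp; field_simp; ring
  · refine (((hl 5).cos.const_mul p).sub ((hl 5).sin.const_mul q)).neg.congr_deriv ?_
    simp; ring
  · refine (htan.neg.mul hrot).congr_deriv ?_
    simp; ring
  · exact hasDerivAt_const _ _
  · exact hasDerivAt_const _ _

lemma second_lieBracket_fMTCP_const (a gx gy gz : ℝ) {x : Fin 8 → ℝ}
    (hx : cos (x 4) ≠ 0) (p q : ℝ) :
    lieBracket (fMTCP a gx gy gz)
        (lieBracket (fMTCP a gx gy gz) (fun _ => ![0, 0, 0, 0, 0, 0, p, q])) x =
      ![a * (cos (x 3) * (p * sin (x 5) + q * cos (x 5)) -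
          sin (x 3) * sin (x 4) * (p * cos (x 5) - q * sin (x 5))),
        -a * cos (x 4) * (p * cos (x 5) - q * sin (x 5)),
        -a * (sin (x 3) * (p * sin (x 5) + q * cos (x 5)) +
          cos (x 3) * sin (x 4) * (p * cos (x 5) - q * sin (x 5))),
        0, 0, p * x 7 - q * x 6, 0, 0] := by
  have hev : ∀ᶠ y : Fin 8 → ℝ in nhds x, cos (y 4) ≠ 0 :=
    (continuous_cos.comp (continuous_apply 4)).continuousAt.eventually_ne hx
  have heq := hev.mono fun y hy => lieBracket_fMTCP_const a gx gy gz hy p q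
  rw [lieBracket, Filter.EventuallyEq.fderiv_eq heq, fderiv_firstBracket_apply p q hx,
    fderiv_fMTCP_apply a gx gy gz hx, lieBracket_fMTCP_const a gx gy gz hx]
  have h4 := sin_sq_add_cos_sq (x 4)
  have h5 := sin_sq_add_cos_sq (x 5)
  ext i
  fin_cases i
  · simp; field_simp; ring
  · simp; ring
  · simp; field_simp; ring
  · simp [fMTCP, tan_eq_sin_div_cos]; field_simp; ring
  · simp [fMTCP, tan_eq_sin_div_cos]; field_simp; ring
  · simp [fMTCP, tan_eq_sin_div_cos]; field_simp; grind
  · simp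
  · simp

/- STATEMENT 4: second-order Lie brackets ad²f.g̃1 and ad²f.g̃2 on U. -/
theorem second_order_brackets (a gx gy gz : ℝ) (x : Fin 8 → ℝ)
    (hx : cos (x 4) ≠ 0) :
    lieBracket (fMTCP a gx gy gz) (lieBracket (fMTCP a gx gy gz) gt1) x =
      ![a * (cos (x 3) * cos (x 5) + sin (x 3) * sin (x 5) * sin (x 4)),
        a * cos (x 4) * sin (x 5),
        -(a * (cos (x 5) * sin (x 3) - sin (x 5) * cos (x 3) * sin (x 4))),
        0, 0, -(x 6), 0, 0] ∧
    lieBracket (fMTCP a gx gy gz) (lieBracket (fMTCP a gx gy gz) gt2) x =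
      ![a * (cos (x 3) * sin (x 5) - sin (x 3) * cos (x 5) * sin (x 4)),
        -(a * cos (x 5) * cos (x 4)),
        -(a * (sin (x 5) * sin (x 3) + cos (x 5) * cos (x 3) * sin (x 4))),
        0, 0, x 7, 0, 0] := by
  have h1 : gt1 = fun _ => ![0, 0, 0, 0, 0, 0, 0, 1] := by
    funext y i
    fin_cases i <;> simp [gt1]
  have h2 : gt2 = fun _ => ![0, 0, 0, 0, 0, 0, 1, 0] := by
    funext y i
    fin_cases i <;> simp [gt2]
  rw [h1, h2, second_lieBracket_fMTCP_const a gx gy gz hx,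
    second_lieBracket_fMTCP_const a gx gy gz hx]
  constructor <;> ext i <;> fin_cases i <;> simp [-mul_eq_mul_left_iff] <;> ring
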